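/- Let (u,v) be a smooth solution of the Pavlov–Mikhalev system on ℝ³. Then the pair (φ^u, φ^v) with φ^u = 0 and φ^v = u_xxx satisfies the linearized system, i.e., it is a symmetry generating function (the symmetry φ₈). -/

import Mathlib

noncomputable section

/-- Partial derivative with respect to the first coordinate `t`. -/
def Dt (f : ℝ → ℝ → ℝ → ℝ) : ℝ → ℝ → ℝ → ℝ := fun t x y => deriv (fun s => f s x y) t

/-- Partial derivative with respect to the second coordinate `x`. -/
def Dx (f : ℝ → ℝ → ℝ → ℝ) : ℝ → ℝ → ℝ → ℝ := fun t x y => deriv (fun s => f t s y) x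

/-- Partial derivative with respect to the third coordinate `y`. -/
def Dy (f : ℝ → ℝ → ℝ → ℝ) : ℝ → ℝ → ℝ → ℝ := fun t x y => deriv (fun s => f t x s) y

/-- `f` is a smooth function on `ℝ³` (given in curried form, coordinates `(t, x, y)`). -/
def Smooth3 (f : ℝ → ℝ → ℝ → ℝ) : Prop :=
  ContDiff ℝ (⊤ : ℕ∞) (fun p : ℝ × ℝ × ℝ => f p.1 p.2.1 p.2.2)

/-- The Pavlov–Mikhalev equation `u_yy = u_xt − u_x·u_xy + u_y·u_xx`. -/
def PMu (u : ℝ → ℝ → ℝ → ℝ) : Prop :=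
  ∀ t x y : ℝ, Dy (Dy u) t x y =
    Dt (Dx u) t x y - Dx u t x y * Dy (Dx u) t x y + Dy u t x y * Dx (Dx u) t x y

/-- The second equation of the two-component Pavlov–Mikhalev system:
`v_yy = v_xt − u_x·v_xy − 2·v_y·u_xx + 2·v_x·u_xy + u_y·v_xx`. -/
def PMv (u v : ℝ → ℝ → ℝ → ℝ) : Prop :=
  ∀ t x y : ℝ, Dy (Dy v) t x y =
    Dt (Dx v) t x y - Dx u t x y * Dy (Dx v) t x y
      - 2 * Dy v t x y * Dx (Dx u) t x y + 2 * Dx v t x y * Dy (Dx u) t x y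
      + Dy u t x y * Dx (Dx v) t x y

/-- First equation of the linearized system applied to `A = φ^u`:
`φ^u_yy = φ^u_xt + u_xx·φ^u_y + u_y·φ^u_xx − u_x·φ^u_xy − u_xy·φ^u_x`. -/
def LinU (u A : ℝ → ℝ → ℝ → ℝ) : Prop :=
  ∀ t x y : ℝ, Dy (Dy A) t x y =
    Dt (Dx A) t x y + Dx (Dx u) t x y * Dy A t x y + Dy u t x y * Dx (Dx A) t x y
      - Dx u t x y * Dy (Dx A) t x y - Dy (Dx u) t x y * Dx A t x y

/-- Second equation of the linearized system applied to `(A, B) = (φ^u, φ^v)`. -/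
def LinV (u v A B : ℝ → ℝ → ℝ → ℝ) : Prop :=
  ∀ t x y : ℝ, Dy (Dy B) t x y =
    2 * Dx v t x y * Dy (Dx A) t x y - Dy (Dx v) t x y * Dx A t x y
      + Dx (Dx v) t x y * Dy A t x y - 2 * Dy v t x y * Dx (Dx A) t x y
      + Dt (Dx B) t x y + 2 * Dy (Dx u) t x y * Dx B t x y
      - 2 * Dx (Dx u) t x y * Dy B t x y + Dy u t x y * Dx (Dx B) t x y
      - Dx u t x y * Dy (Dx B) t x y

/-- `(A,B)` is a symmetry generating function of the Pavlov–Mikhalev system over `(u,v)`. -/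
def IsSymmetry (u v A B : ℝ → ℝ → ℝ → ℝ) : Prop := LinU u A ∧ LinV u v A B

/-- First equation of the tangent system over a solution `(u,v)`:
`p_yy = u_y·p_xx − u_xy·p_x − u_x·p_xy + u_xx·p_y + p_xt`. -/
def TanP (u p : ℝ → ℝ → ℝ → ℝ) : Prop :=
  ∀ t x y : ℝ, Dy (Dy p) t x y =
    Dy u t x y * Dx (Dx p) t x y - Dy (Dx u) t x y * Dx p t x y
      - Dx u t x y * Dy (Dx p) t x y + Dx (Dx u) t x y * Dy p t x y + Dt (Dx p) t x y

/-- Second equation of the tangent system over a solution `(u,v)`: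
`q_yy = 2·v_x·p_xy + v_xx·p_y − v_xy·p_x − 2·v_y·p_xx + 2·u_xy·q_x + u_y·q_xx
  − u_x·q_xy − 2·u_xx·q_y + q_xt`. -/
def TanQ (u v p q : ℝ → ℝ → ℝ → ℝ) : Prop :=
  ∀ t x y : ℝ, Dy (Dy q) t x y =
    2 * Dx v t x y * Dy (Dx p) t x y + Dx (Dx v) t x y * Dy p t x y
      - Dy (Dx v) t x y * Dx p t x y - 2 * Dy v t x y * Dx (Dx p) t x y
      + 2 * Dy (Dx u) t x y * Dx q t x y + Dy u t x y * Dx (Dx q) t x y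
      - Dx u t x y * Dy (Dx q) t x y - 2 * Dx (Dx u) t x y * Dy q t x y
      + Dt (Dx q) t x y


/-- Mixed directional derivatives of a smooth function commute. -/
theorem fderiv_fderiv_apply_comm {F : ℝ × ℝ × ℝ → ℝ} (hF : ContDiff ℝ (⊤ : ℕ∞) F)
    (p v w : ℝ × ℝ × ℝ) :
    fderiv ℝ (fun q => fderiv ℝ F q v) p w = fderiv ℝ (fun q => fderiv ℝ F q w) p v := by
  have hd : DifferentiableAt ℝ (fderiv ℝ F) p :=
    (hF.fderiv_right (m := (⊤ : ℕ∞)) (by simp)).differentiable (by simp) p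
  have hs : IsSymmSndFDerivAt ℝ F p :=
    hF.contDiffAt.isSymmSndFDerivAt
      (by simpa using WithTop.coe_le_coe.2 (le_top : (2 : ℕ∞) ≤ ⊤))
  rw [fderiv_clm_apply hd (differentiableAt_const v),
    fderiv_clm_apply hd (differentiableAt_const w)]
  simpa using hs.eq w v

theorem Smooth3.hasDerivAt_Dt {f : ℝ → ℝ → ℝ → ℝ} (hf : Smooth3 f) (t x y : ℝ) :
    HasDerivAt (fun s => f s x y)
      (fderiv ℝ (fun p : ℝ × ℝ × ℝ => f p.1 p.2.1 p.2.2) (t, x, y) (1, 0, 0)) t := by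
  have h : HasFDerivAt (fun p : ℝ × ℝ × ℝ => f p.1 p.2.1 p.2.2) _ (t, x, y) :=
    (ContDiff.differentiable hf (by simp) _).hasFDerivAt
  have hc : HasDerivAt (fun s : ℝ => (s, x, y)) (1, 0, 0) t :=
    (hasDerivAt_id t).prodMk (hasDerivAt_const t (x, y))
  exact h.comp_hasDerivAt_of_eq _ hc rfl

theorem Smooth3.Dt_eq {f : ℝ → ℝ → ℝ → ℝ} (hf : Smooth3 f) (t x y : ℝ) :
    Dt f t x y = fderiv ℝ (fun p : ℝ × ℝ × ℝ => f p.1 p.2.1 p.2.2) (t, x, y) (1, 0, 0) :=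
  (hf.hasDerivAt_Dt t x y).deriv

theorem Smooth3.dt {f : ℝ → ℝ → ℝ → ℝ} (hf : Smooth3 f) : Smooth3 (Dt f) := by
  have h : (fun p : ℝ × ℝ × ℝ => Dt f p.1 p.2.1 p.2.2) =
      fun p => fderiv ℝ (fun p : ℝ × ℝ × ℝ => f p.1 p.2.1 p.2.2) p (1, 0, 0) :=
    funext fun p => hf.Dt_eq p.1 p.2.1 p.2.2
  unfold Smooth3
  rw [h]
  exact (ContDiff.fderiv_right hf (by simp)).clm_apply contDiff_const

theorem Smooth3.hasDerivAt_Dx {f : ℝ → ℝ → ℝ → ℝ} (hf : Smooth3 f) (t x y : ℝ) :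
    HasDerivAt (fun s => f t s y)
      (fderiv ℝ (fun p : ℝ × ℝ × ℝ => f p.1 p.2.1 p.2.2) (t, x, y) (0, 1, 0)) x := by
  have h : HasFDerivAt (fun p : ℝ × ℝ × ℝ => f p.1 p.2.1 p.2.2) _ (t, x, y) :=
    (ContDiff.differentiable hf (by simp) _).hasFDerivAt
  have hc : HasDerivAt (fun s : ℝ => (t, s, y)) (0, 1, 0) x :=
    (hasDerivAt_const x t).prodMk ((hasDerivAt_id x).prodMk (hasDerivAt_const x y))
  exact h.comp_hasDerivAt_of_eq _ hc rfl

theorem Smooth3.Dx_eq {f : ℝ → ℝ → ℝ → ℝ} (hf : Smooth3 f) (t x y : ℝ) :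
    Dx f t x y = fderiv ℝ (fun p : ℝ × ℝ × ℝ => f p.1 p.2.1 p.2.2) (t, x, y) (0, 1, 0) :=
  (hf.hasDerivAt_Dx t x y).deriv

theorem Smooth3.dx {f : ℝ → ℝ → ℝ → ℝ} (hf : Smooth3 f) : Smooth3 (Dx f) := by
  have h : (fun p : ℝ × ℝ × ℝ => Dx f p.1 p.2.1 p.2.2) =
      fun p => fderiv ℝ (fun p : ℝ × ℝ × ℝ => f p.1 p.2.1 p.2.2) p (0, 1, 0) :=
    funext fun p => hf.Dx_eq p.1 p.2.1 p.2.2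
  unfold Smooth3
  rw [h]
  exact (ContDiff.fderiv_right hf (by simp)).clm_apply contDiff_const

theorem Smooth3.hasDerivAt_Dy {f : ℝ → ℝ → ℝ → ℝ} (hf : Smooth3 f) (t x y : ℝ) :
    HasDerivAt (fun s => f t x s)
      (fderiv ℝ (fun p : ℝ × ℝ × ℝ => f p.1 p.2.1 p.2.2) (t, x, y) (0, 0, 1)) y := by
  have h : HasFDerivAt (fun p : ℝ × ℝ × ℝ => f p.1 p.2.1 p.2.2) _ (t, x, y) :=
    (ContDiff.differentiable hf (by simp) _).hasFDerivAt
  have hc : HasDerivAt (fun s : ℝ => (t, x, s)) (0, 0, 1) y :=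
    (hasDerivAt_const y t).prodMk ((hasDerivAt_const y x).prodMk (hasDerivAt_id y))
  exact h.comp_hasDerivAt_of_eq _ hc rfl

theorem Smooth3.Dy_eq {f : ℝ → ℝ → ℝ → ℝ} (hf : Smooth3 f) (t x y : ℝ) :
    Dy f t x y = fderiv ℝ (fun p : ℝ × ℝ × ℝ => f p.1 p.2.1 p.2.2) (t, x, y) (0, 0, 1) :=
  (hf.hasDerivAt_Dy t x y).deriv

theorem Smooth3.dy {f : ℝ → ℝ → ℝ → ℝ} (hf : Smooth3 f) : Smooth3 (Dy f) := by
  have h : (fun p : ℝ × ℝ × ℝ => Dy f p.1 p.2.1 p.2.2) =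
      fun p => fderiv ℝ (fun p : ℝ × ℝ × ℝ => f p.1 p.2.1 p.2.2) p (0, 0, 1) :=
    funext fun p => hf.Dy_eq p.1 p.2.1 p.2.2
  unfold Smooth3
  rw [h]
  exact (ContDiff.fderiv_right hf (by simp)).clm_apply contDiff_const

theorem Smooth3.Dx_Dt {f : ℝ → ℝ → ℝ → ℝ} (hf : Smooth3 f) : Dx (Dt f) = Dt (Dx f) := by
  funext t x y
  rw [hf.dt.Dx_eq, hf.dx.Dt_eq]
  simp only [hf.Dt_eq, hf.Dx_eq]
  exact fderiv_fderiv_apply_comm hf _ _ _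

theorem Smooth3.Dx_Dy {f : ℝ → ℝ → ℝ → ℝ} (hf : Smooth3 f) : Dx (Dy f) = Dy (Dx f) := by
  funext t x y
  rw [hf.dy.Dx_eq, hf.dx.Dy_eq]
  simp only [hf.Dy_eq, hf.Dx_eq]
  exact fderiv_fderiv_apply_comm hf _ _ _

theorem Smooth3.add {f g : ℝ → ℝ → ℝ → ℝ} (hf : Smooth3 f) (hg : Smooth3 g) :
    Smooth3 (f + g) :=
  ContDiff.add hf hg

theorem Smooth3.Dx_add {f g : ℝ → ℝ → ℝ → ℝ} (hf : Smooth3 f) (hg : Smooth3 g) :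
    Dx (f + g) = Dx f + Dx g := by
  funext t x y
  exact deriv_fun_add (hf.hasDerivAt_Dx t x y).differentiableAt
    (hg.hasDerivAt_Dx t x y).differentiableAt

theorem Smooth3.sub {f g : ℝ → ℝ → ℝ → ℝ} (hf : Smooth3 f) (hg : Smooth3 g) :
    Smooth3 (f - g) :=
  ContDiff.sub hf hg

theorem Smooth3.Dx_sub {f g : ℝ → ℝ → ℝ → ℝ} (hf : Smooth3 f) (hg : Smooth3 g) :
    Dx (f - g) = Dx f - Dx g := by
  funext t x y
  exact deriv_fun_sub (hf.hasDerivAt_Dx t x y).differentiableAt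
    (hg.hasDerivAt_Dx t x y).differentiableAt

theorem Smooth3.mul {f g : ℝ → ℝ → ℝ → ℝ} (hf : Smooth3 f) (hg : Smooth3 g) :
    Smooth3 (f * g) :=
  ContDiff.mul hf hg

theorem Smooth3.Dx_mul {f g : ℝ → ℝ → ℝ → ℝ} (hf : Smooth3 f) (hg : Smooth3 g) :
    Dx (f * g) = Dx f * g + f * Dx g := by
  funext t x y
  exact deriv_fun_mul (hf.hasDerivAt_Dx t x y).differentiableAt
    (hg.hasDerivAt_Dx t x y).differentiableAt

/-- Third `x`-derivative of the bracket `g f_x - f g_x`: the mixed second-order terms cancel. -/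
theorem Smooth3.Dx_Dx_Dx_wronskian {f g : ℝ → ℝ → ℝ → ℝ} (hf : Smooth3 f) (hg : Smooth3 g) :
    Dx (Dx (Dx (g * Dx f - f * Dx g))) =
      g * Dx (Dx (Dx (Dx f)))
        + 2 * Dx g * Dx (Dx (Dx f))
        - 2 * Dx f * Dx (Dx (Dx g))
        - f * Dx (Dx (Dx (Dx g))) := by
  have hf2 := hf.dx.dx
  have hg2 := hg.dx.dx
  have h1 : Dx (g * Dx f - f * Dx g) =
      g * Dx (Dx f) - f * Dx (Dx g) := by
    rw [(hg.mul hf.dx).Dx_sub (hf.mul hg.dx), hg.Dx_mul hf.dx, hf.Dx_mul hg.dx]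
    ring
  rw [h1, (hg.mul hf2).Dx_sub (hf.mul hg2), hg.Dx_mul hf2, hf.Dx_mul hg2,
    ((hg.dx.mul hf2).add (hg.mul hf2.dx)).Dx_sub ((hf.dx.mul hg2).add (hf.mul hg2.dx)),
    (hg.dx.mul hf2).Dx_add (hg.mul hf2.dx), (hf.dx.mul hg2).Dx_add (hf.mul hg2.dx),
    hg.dx.Dx_mul hf2, hg.Dx_mul hf2.dx, hf.dx.Dx_mul hg2, hf.Dx_mul hg2.dx]
  ring

theorem phi8_is_symmetry (u v : ℝ → ℝ → ℝ → ℝ) (hu : Smooth3 u) (hv : Smooth3 v)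
    (hPMu : PMu u) (hPMv : PMv u v) :
    IsSymmetry u v
      (fun _t _x _y => (0 : ℝ))
      (fun t x y => Dx (Dx (Dx u)) t x y) := by
  refine ⟨fun t x y => by simp [Dx, Dy, Dt], fun t x y => ?_⟩
  have key : Dy (Dy u) = Dt (Dx u) + (Dy u * Dx (Dx u) - Dx u * Dx (Dy u)) := by
    funext t x y
    rw [hu.Dx_Dy]
    simp only [Pi.add_apply, Pi.sub_apply, Pi.mul_apply]
    rw [hPMu]
    ring
  have hb : Smooth3 (Dy u * Dx (Dx u) - Dx u * Dx (Dy u)) :=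
    (hu.dy.mul hu.dx.dx).sub (hu.dx.mul hu.dy.dx)
  have hyy : Dy (Dy (Dx (Dx (Dx u)))) = Dx (Dx (Dx (Dy (Dy u)))) := by
    rw [hu.dy.Dx_Dy, hu.Dx_Dy, hu.dx.dy.Dx_Dy, hu.dx.Dx_Dy, hu.dx.dx.dy.Dx_Dy, hu.dx.dx.Dx_Dy]
  have hy : Dx (Dx (Dx (Dy u))) = Dy (Dx (Dx (Dx u))) := by
    rw [hu.Dx_Dy, hu.dx.Dx_Dy, hu.dx.dx.Dx_Dy]
  have ht : Dx (Dx (Dx (Dt (Dx u)))) = Dt (Dx (Dx (Dx (Dx u)))) := by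
    rw [hu.dx.Dx_Dt, hu.dx.dx.Dx_Dt, hu.dx.dx.dx.Dx_Dt]
  have main : Dy (Dy (Dx (Dx (Dx u)))) = Dt (Dx (Dx (Dx (Dx u))))
      + (Dy u * Dx (Dx (Dx (Dx (Dx u)))) + 2 * Dy (Dx u) * Dx (Dx (Dx (Dx u)))
        - 2 * Dx (Dx u) * Dy (Dx (Dx (Dx u))) - Dx u * Dy (Dx (Dx (Dx (Dx u))))) := by
    rw [hyy, key, hu.dx.dt.Dx_add hb, hu.dx.dt.dx.Dx_add hb.dx, hu.dx.dt.dx.dx.Dx_add hb.dx.dx, ht,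
      hu.dx.Dx_Dx_Dx_wronskian hu.dy, hy, hu.Dx_Dy, hu.dx.dx.dx.Dx_Dy]
  have hx0 : Dx (fun _ _ _ => (0 : ℝ)) = fun _ _ _ => 0 := by
    funext t x y
    simp [Dx]
  have hy0 : Dy (fun _ _ _ => (0 : ℝ)) = fun _ _ _ => 0 := by
    funext t x y
    simp [Dy]
  have h := congrFun (congrFun (congrFun main t) x) y
  simp only [Pi.add_apply, Pi.sub_apply, Pi.mul_apply, Pi.ofNat_apply] at h
  simp only [hx0, hy0]
  linear_combination h
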